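/- Let ℓ ≤ n be positive integers and let H be a subgroup of S_n. Then the following are equivalent: (a) H is Galois closed, i.e., H = gComp^n(gPat_ℓ(H)); (a') there exists a subgroup G ≤ S_ℓ with H = gComp^n(G); (b) H = Aut(pcInv H); (c) there exist k ≤ ℓ and a relation ρ ⊆ [n]^k whose tuples have pairwise distinct entries such that ρ = (ρ̌)̂ and H = Aut ρ. -/

import Mathlib

open Equiv Finset Function

/-- `h_I : [ℓ] → [n]`: the increasing enumeration of an `ℓ`-element subset `I ⊆ [n]`,
i.e., the unique order isomorphism `([ℓ], ≤) → (I, ≤)` viewed as a map into `[n]`. -/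
def hmap {ℓ n : ℕ} (I : Finset (Fin n)) (hI : I.card = ℓ) : Fin ℓ → Fin n :=
  fun i => ((I.orderIsoOfFin hI) i : Fin n)

theorem hmap_injective {ℓ n : ℕ} (I : Finset (Fin n)) (hI : I.card = ℓ) :
    Function.Injective (hmap I hI) := fun a b h =>
  (I.orderIsoOfFin hI).injective (Subtype.ext h)

theorem mem_image_iff_perm {n : ℕ} (π : Equiv.Perm (Fin n)) (I : Finset (Fin n)) (a : Fin n) :
    a ∈ I ↔ π a ∈ I.image ⇑π := by
  constructor
  · exact fun h => Finset.mem_image_of_mem _ h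
  · intro h
    obtain ⟨b, hb, hba⟩ := Finset.mem_image.mp h
    rwa [← π.injective hba]

/-- The pattern `π_I := h_{π(I)}⁻¹ ∘ π ∘ h_I ∈ S_ℓ` of `π ∈ S_n` at an `ℓ`-element
subset `I ⊆ [n]`. -/
def patt {ℓ n : ℕ} (π : Equiv.Perm (Fin n)) (I : Finset (Fin n)) (hI : I.card = ℓ) :
    Equiv.Perm (Fin ℓ) :=
  (I.orderIsoOfFin hI).toEquiv.trans
    ((π.subtypeEquiv (mem_image_iff_perm π I)).trans
      ((I.image ⇑π).orderIsoOfFin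
        (by rw [Finset.card_image_of_injective _ π.injective, hI])).toEquiv.symm)

/-- `Pat_ℓ(π)`: the set of `ℓ`-patterns of `π ∈ S_n`. -/
def PattSet (ℓ : ℕ) {n : ℕ} (π : Equiv.Perm (Fin n)) : Set (Equiv.Perm (Fin ℓ)) :=
  {σ | ∃ (I : Finset (Fin n)) (hI : I.card = ℓ), σ = patt π I hI}

/-- `Comp^n(S)`: the set of `n`-permutations all of whose `ℓ`-patterns lie in `S`. -/
def CompSet (n : ℕ) {ℓ : ℕ} (S : Set (Equiv.Perm (Fin ℓ))) : Set (Equiv.Perm (Fin n)) :=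
  {τ | PattSet ℓ τ ⊆ S}

/-- Pattern involvement: `σ ≤ π` iff `σ = π_I` for some `ℓ`-element subset `I`. -/
def Involves {ℓ n : ℕ} (σ : Equiv.Perm (Fin ℓ)) (π : Equiv.Perm (Fin n)) : Prop :=
  σ ∈ PattSet ℓ π

/-- `gPat_ℓ(H)`: the subgroup of `S_ℓ` generated by the `ℓ`-patterns of members of `H`. -/
def gPat (ℓ : ℕ) {n : ℕ} (H : Set (Equiv.Perm (Fin n))) : Subgroup (Equiv.Perm (Fin ℓ)) :=
  Subgroup.closure (⋃ τ ∈ H, PattSet ℓ τ)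

/-- A function preserves a `k`-ary relation (componentwise application keeps tuples in
the relation). -/
def Preserves {α : Type*} {k : ℕ} (f : α → α) (ρ : Set (Fin k → α)) : Prop :=
  ∀ r ∈ ρ, (f ∘ r) ∈ ρ

/-- The `ℓ`-orbit `a^H = {σ ∘ a : σ ∈ H}`. -/
def orbitRel {ℓ n : ℕ} (H : Subgroup (Equiv.Perm (Fin n))) (a : Fin ℓ → Fin n) :
    Set (Fin ℓ → Fin n) :=
  {x | ∃ σ ∈ H, x = ⇑σ ∘ a}

/-- The reduction `red(u) = h_{range u}⁻¹ ∘ u` of a tuple with pairwise distinct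
entries. -/
def red {k n : ℕ} (u : Fin k → Fin n) (hu : Function.Injective u) : Fin k → Fin k :=
  fun i =>
    ((Finset.univ.image u).orderIsoOfFin
      (by rw [Finset.card_image_of_injective _ hu]; simp)).symm
      ⟨u i, Finset.mem_image_of_mem _ (Finset.mem_univ i)⟩

/-- `red(ρ) = {red(r) : r ∈ ρ}` for a set `ρ` of tuples with pairwise distinct entries. -/
def redSet {k n : ℕ} (ρ : Set (Fin k → Fin n)) : Set (Fin k → Fin k) :=
  {v | ∃ (r : Fin k → Fin n) (_ : r ∈ ρ) (hr : Function.Injective r), v = red r hr}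

/-- `ρ̌ := {h_I⁻¹ ∘ r : r ∈ ρ, range r ⊆ I, I an ℓ-element subset of [n]}`. -/
def checkRel (ℓ : ℕ) {k n : ℕ} (ρ : Set (Fin k → Fin n)) : Set (Fin k → Fin ℓ) :=
  {s | ∃ (r : Fin k → Fin n) (_ : r ∈ ρ) (I : Finset (Fin n)) (hI : I.card = ℓ)
        (hr : ∀ j, r j ∈ I), s = fun j => (I.orderIsoOfFin hI).symm ⟨r j, hr j⟩}

/-- `σ̂ := {h_J ∘ s : s ∈ σ, J an ℓ-element subset of [n]}`. -/
def hatRel (n : ℕ) {k ℓ : ℕ} (σ : Set (Fin k → Fin ℓ)) : Set (Fin k → Fin n) :=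
  {r | ∃ (s : Fin k → Fin ℓ) (_ : s ∈ σ) (J : Finset (Fin n)) (hJ : J.card = ℓ),
        r = hmap J hJ ∘ s}

/-- `ρ` is a pattern closed relation (pc-relation): for every `r ∈ ρ` and all
`ℓ`-element subsets `I, J ⊆ [n]` with `range r ⊆ I`, the tuple `h_J ∘ h_I⁻¹ ∘ r`
belongs to `ρ`. -/
def IsPC (ℓ : ℕ) {k n : ℕ} (ρ : Set (Fin k → Fin n)) : Prop :=
  ∀ r ∈ ρ, ∀ (I J : Finset (Fin n)) (hI : I.card = ℓ) (hJ : J.card = ℓ)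
    (hr : ∀ j, r j ∈ I),
    (fun j => hmap J hJ ((I.orderIsoOfFin hI).symm ⟨r j, hr j⟩)) ∈ ρ

theorem hmap_mem {ℓ n : ℕ} (I : Finset (Fin n)) (hI : I.card = ℓ) (i : Fin ℓ) :
    hmap I hI i ∈ I :=
  (I.orderIsoOfFin hI i).2

theorem hmap_symm {ℓ n : ℕ} (I : Finset (Fin n)) (hI : I.card = ℓ) (x : I) :
    hmap I hI ((I.orderIsoOfFin hI).symm x) = x := by
  simp [hmap]

theorem card_image_perm {ℓ n : ℕ} (π : Perm (Fin n)) {I : Finset (Fin n)} (hI : I.card = ℓ) :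
    (I.image ⇑π).card = ℓ := by
  rw [Finset.card_image_of_injective _ π.injective, hI]

theorem hmap_patt {ℓ n : ℕ} (π : Perm (Fin n)) (I : Finset (Fin n)) (hI : I.card = ℓ)
    (i : Fin ℓ) :
    hmap (I.image ⇑π) (card_image_perm π hI) (patt π I hI i) = π (hmap I hI i) := by
  simp [hmap, patt]

theorem hmap_comp_patt {ℓ n k : ℕ} (π : Perm (Fin n)) (I : Finset (Fin n)) (hI : I.card = ℓ)
    (s : Fin k → Fin ℓ) :
    hmap (I.image ⇑π) (card_image_perm π hI) ∘ (patt π I hI ∘ s) = π ∘ (hmap I hI ∘ s) :=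
  funext fun _ => hmap_patt π I hI _

theorem mem_checkRel_iff {ℓ n k : ℕ} {ρ : Set (Fin k → Fin n)} (hρ : IsPC ℓ ρ)
    (I : Finset (Fin n)) (hI : I.card = ℓ) (s : Fin k → Fin ℓ) :
    s ∈ checkRel ℓ ρ ↔ hmap I hI ∘ s ∈ ρ := by
  constructor
  · rintro ⟨r, hr, J, hJ, hrJ, rfl⟩
    exact hρ r hr J I hJ hI hrJ
  · intro h
    refine ⟨_, h, I, hI, fun j => hmap_mem I hI _, funext fun j => ?_⟩
    exact ((I.orderIsoOfFin hI).symm_apply_apply (s j)).symm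

theorem isPC_of_eq_hatRel_checkRel {ℓ n k : ℕ} {ρ : Set (Fin k → Fin n)}
    (hρ : ρ = hatRel n (checkRel ℓ ρ)) : IsPC ℓ ρ := by
  intro r hr I J hI hJ hrI
  rw [hρ]
  exact ⟨_, ⟨r, hr, I, hI, hrI, rfl⟩, J, hJ, rfl⟩

/-- A tuple of length at most `ℓ` factors through the enumeration of an `ℓ`-element set. -/
theorem exists_eq_hmap_comp {ℓ n k : ℕ} (hk : k ≤ ℓ) (hn : ℓ ≤ n) (r : Fin k → Fin n) :
    ∃ (I : Finset (Fin n)) (hI : I.card = ℓ) (s : Fin k → Fin ℓ), r = hmap I hI ∘ s := by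
  obtain ⟨I, hrI, hI⟩ := Finset.exists_superset_card_eq (s := univ.image r) (n := ℓ)
    ((card_image_le.trans (by simp)).trans hk) (by simpa using hn)
  refine ⟨I, hI, fun j => (I.orderIsoOfFin hI).symm
    ⟨r j, hrI (mem_image_of_mem _ (mem_univ j))⟩, funext fun j => ?_⟩
  exact (hmap_symm I hI ⟨r j, _⟩).symm

theorem gPat_mem_checkRel_iff {ℓ n k : ℕ} {H : Subgroup (Perm (Fin n))}
    {ρ : Set (Fin k → Fin n)} (hρ : IsPC ℓ ρ) (hH : ∀ τ ∈ H, Preserves ⇑τ ρ)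
    {g : Perm (Fin ℓ)} (hg : g ∈ gPat ℓ (H : Set (Perm (Fin n)))) (s : Fin k → Fin ℓ) :
    g ∘ s ∈ checkRel ℓ ρ ↔ s ∈ checkRel ℓ ρ := by
  induction hg using Subgroup.closure_induction generalizing s with
  | mem g hg =>
    simp only [Set.mem_iUnion] at hg
    obtain ⟨τ, hτ, I, hI, rfl⟩ := hg
    rw [mem_checkRel_iff hρ _ (card_image_perm τ hI), hmap_comp_patt,
      mem_checkRel_iff hρ I hI]
    refine ⟨fun h => ?_, hH τ hτ _⟩
    have h' := hH τ⁻¹ (H.inv_mem hτ) _ h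
    rwa [← comp_assoc, ← Perm.coe_mul, inv_mul_cancel, Perm.coe_one, id_comp] at h'
  | one => rfl
  | mul x y _ _ hx hy => rw [Perm.coe_mul, comp_assoc, hx, hy]
  | inv x _ hx =>
    rw [← hx, ← comp_assoc, ← Perm.coe_mul, mul_inv_cancel, Perm.coe_one, id_comp]

theorem compSet_gPat_preserves {ℓ n k : ℕ} (hk : k ≤ ℓ) (hn : ℓ ≤ n)
    {H : Subgroup (Perm (Fin n))} {ρ : Set (Fin k → Fin n)} (hρ : IsPC ℓ ρ)
    (hH : ∀ τ ∈ H, Preserves ⇑τ ρ) {π : Perm (Fin n)}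
    (hπ : π ∈ CompSet n (gPat ℓ (H : Set (Perm (Fin n))) : Set (Perm (Fin ℓ)))) :
    Preserves ⇑π ρ := by
  intro r hr
  obtain ⟨I, hI, s, rfl⟩ := exists_eq_hmap_comp hk hn r
  rw [← hmap_comp_patt, ← mem_checkRel_iff hρ,
    gPat_mem_checkRel_iff hρ hH (hπ ⟨I, hI, rfl⟩), mem_checkRel_iff hρ I hI]
  exact hr

theorem subset_compSet_gPat {ℓ n : ℕ} (H : Set (Perm (Fin n))) :
    H ⊆ CompSet n (gPat ℓ H : Set (Perm (Fin ℓ))) := fun _ hτ _ hσ =>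
  Subgroup.subset_closure (Set.mem_biUnion hτ hσ)

theorem gPat_le_of_subset_compSet {ℓ n : ℕ} {H : Set (Perm (Fin n))}
    {G : Subgroup (Perm (Fin ℓ))} (h : H ⊆ CompSet n (G : Set (Perm (Fin ℓ)))) :
    gPat ℓ H ≤ G :=
  (Subgroup.closure_le G).2 (Set.iUnion₂_subset h)

theorem compSet_mono {ℓ n : ℕ} {S T : Set (Perm (Fin ℓ))} (h : S ⊆ T) :
    CompSet n S ⊆ CompSet n T := fun _ hτ => hτ.trans h

/-- The set of tuples `g : Fin ℓ → Fin ℓ` given by the members of a permutation group. -/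
def permTuples {ℓ : ℕ} (G : Subgroup (Perm (Fin ℓ))) : Set (Fin ℓ → Fin ℓ) :=
  {s | ∃ g ∈ G, s = ⇑g}

theorem eq_of_hmap_comp_eq {ℓ n : ℕ} {I J : Finset (Fin n)} {hI : I.card = ℓ}
    {hJ : J.card = ℓ} {g g' : Perm (Fin ℓ)} (h : hmap I hI ∘ g = hmap J hJ ∘ g') :
    g = g' := by
  have hIJ : I = J := by
    refine eq_of_subset_of_card_le (fun x hx => ?_) (by rw [hI, hJ])
    have hx' := congrFun h (g.symm ((I.orderIsoOfFin hI).symm ⟨x, hx⟩))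
    simp only [comp_apply, apply_symm_apply, hmap_symm] at hx'
    rw [hx']
    exact hmap_mem J hJ _
  subst hIJ
  exact Equiv.ext fun i => hmap_injective I hI (congrFun h i)

theorem hmap_comp_mem_hatRel_permTuples {ℓ n : ℕ} {G : Subgroup (Perm (Fin ℓ))}
    (I : Finset (Fin n)) (hI : I.card = ℓ) (g : Perm (Fin ℓ)) :
    hmap I hI ∘ g ∈ hatRel n (permTuples G) ↔ g ∈ G := by
  constructor
  · rintro ⟨_, ⟨g', hg', rfl⟩, J, hJ, h⟩
    rwa [eq_of_hmap_comp_eq h]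
  · exact fun hg => ⟨_, ⟨g, hg, rfl⟩, I, hI, rfl⟩

theorem injective_of_mem_hatRel_permTuples {ℓ n : ℕ} {G : Subgroup (Perm (Fin ℓ))}
    {r : Fin ℓ → Fin n} (hr : r ∈ hatRel n (permTuples G)) : Injective r := by
  obtain ⟨_, ⟨g, -, rfl⟩, J, hJ, rfl⟩ := hr
  exact (hmap_injective J hJ).comp g.injective

theorem checkRel_hatRel_permTuples {ℓ n : ℕ} (hn : ℓ ≤ n) (G : Subgroup (Perm (Fin ℓ))) :
    checkRel ℓ (hatRel n (permTuples G)) = permTuples G := by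
  ext s
  constructor
  · rintro ⟨_, ⟨_, ⟨g, hg, rfl⟩, J, hJ, rfl⟩, I, hI, hr, rfl⟩
    have hJI : J = I := by
      refine eq_of_subset_of_card_le (fun x hx => ?_) (by rw [hI, hJ])
      simpa [hmap_symm] using hr (g.symm ((J.orderIsoOfFin hJ).symm ⟨x, hx⟩))
    subst hJI
    exact ⟨g, hg, funext fun j => (J.orderIsoOfFin hI).symm_apply_apply (g j)⟩
  · intro hs
    obtain ⟨I, -, hI⟩ := Finset.exists_superset_card_eq (s := (∅ : Finset (Fin n))) (n := ℓ)
      (by simp) (by simpa using hn)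
    exact ⟨_, ⟨s, hs, I, hI, rfl⟩, I, hI, fun j => hmap_mem I hI _,
      funext fun j => ((I.orderIsoOfFin hI).symm_apply_apply (s j)).symm⟩

theorem compSet_eq_preserves_hatRel_permTuples {ℓ n : ℕ} (G : Subgroup (Perm (Fin ℓ))) :
    CompSet n (G : Set (Perm (Fin ℓ))) =
      {π : Perm (Fin n) | Preserves ⇑π (hatRel n (permTuples G))} := by
  ext π
  constructor
  · rintro hπ _ ⟨_, ⟨g, hg, rfl⟩, J, hJ, rfl⟩
    rw [← hmap_comp_patt, ← Perm.coe_mul, hmap_comp_mem_hatRel_permTuples]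
    exact G.mul_mem (hπ ⟨J, hJ, rfl⟩) hg
  · rintro hπ _ ⟨I, hI, rfl⟩
    have h := hπ _ ((hmap_comp_mem_hatRel_permTuples I hI 1).2 G.one_mem)
    rw [← hmap_comp_patt, ← Perm.coe_mul, hmap_comp_mem_hatRel_permTuples, mul_one] at h
    exact h

/-- Theorem 5.3(B): for a subgroup `H ≤ S_n` the following are equivalent:
(a) `H = gComp^n(gPat_ℓ(H))`; (a') `H = gComp^n(G)` for some `G ≤ S_ℓ`;
(b) `H = Aut (pcInv H)`; (c) `H = Aut ρ` for some relation `ρ ⊆ [n]^k_≠` (`k ≤ ℓ`)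
with `ρ = (ρ̌)̂`. -/
theorem stmt15 (ℓ n : ℕ) (hℓ : 0 < ℓ) (hn : ℓ ≤ n) (H : Subgroup (Equiv.Perm (Fin n))) :
    (((H : Set (Equiv.Perm (Fin n))) =
        CompSet n ((gPat ℓ (H : Set (Equiv.Perm (Fin n)))) : Set (Equiv.Perm (Fin ℓ)))) ↔
      (∃ G : Subgroup (Equiv.Perm (Fin ℓ)),
        (H : Set (Equiv.Perm (Fin n))) = CompSet n (G : Set (Equiv.Perm (Fin ℓ))))) ∧
    ((∃ G : Subgroup (Equiv.Perm (Fin ℓ)),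
        (H : Set (Equiv.Perm (Fin n))) = CompSet n (G : Set (Equiv.Perm (Fin ℓ)))) ↔
      ((H : Set (Equiv.Perm (Fin n))) =
        {π : Equiv.Perm (Fin n) | ∀ (k : ℕ), 0 < k → k ≤ ℓ →
          ∀ ρ : Set (Fin k → Fin n), IsPC ℓ ρ →
            (∀ τ ∈ H, Preserves ⇑τ ρ) → Preserves ⇑π ρ})) ∧
    (((H : Set (Equiv.Perm (Fin n))) =
        {π : Equiv.Perm (Fin n) | ∀ (k : ℕ), 0 < k → k ≤ ℓ →
          ∀ ρ : Set (Fin k → Fin n), IsPC ℓ ρ →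
            (∀ τ ∈ H, Preserves ⇑τ ρ) → Preserves ⇑π ρ}) ↔
      (∃ (k : ℕ), 0 < k ∧ k ≤ ℓ ∧ ∃ ρ : Set (Fin k → Fin n),
        (∀ r ∈ ρ, Function.Injective r) ∧ ρ = hatRel n (checkRel ℓ ρ) ∧
        (H : Set (Equiv.Perm (Fin n))) =
          {π : Equiv.Perm (Fin n) | Preserves ⇑π ρ})) := by
  have ha : ∀ G : Subgroup (Perm (Fin ℓ)),
      (H : Set (Perm (Fin n))) = CompSet n (G : Set (Perm (Fin ℓ))) →
      (H : Set (Perm (Fin n))) = CompSet n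
        (gPat ℓ (H : Set (Perm (Fin n))) : Set (Perm (Fin ℓ))) := fun G hG =>
    (subset_compSet_gPat _).antisymm
      ((compSet_mono (gPat_le_of_subset_compSet hG.subset)).trans hG.superset)
  have hac : (∃ G : Subgroup (Perm (Fin ℓ)),
      (H : Set (Perm (Fin n))) = CompSet n (G : Set (Perm (Fin ℓ)))) →
      ∃ (k : ℕ), 0 < k ∧ k ≤ ℓ ∧ ∃ ρ : Set (Fin k → Fin n),
        (∀ r ∈ ρ, Function.Injective r) ∧ ρ = hatRel n (checkRel ℓ ρ) ∧
        (H : Set (Perm (Fin n))) = {π : Perm (Fin n) | Preserves ⇑π ρ} := by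
    rintro ⟨G, hG⟩
    refine ⟨ℓ, hℓ, le_rfl, hatRel n (permTuples G),
      fun r => injective_of_mem_hatRel_permTuples, ?_, ?_⟩
    · rw [checkRel_hatRel_permTuples hn]
    · rw [hG, compSet_eq_preserves_hatRel_permTuples]
  have hcb : (∃ (k : ℕ), 0 < k ∧ k ≤ ℓ ∧ ∃ ρ : Set (Fin k → Fin n),
        (∀ r ∈ ρ, Function.Injective r) ∧ ρ = hatRel n (checkRel ℓ ρ) ∧
        (H : Set (Perm (Fin n))) = {π : Perm (Fin n) | Preserves ⇑π ρ}) →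
      (H : Set (Perm (Fin n))) = {π : Perm (Fin n) | ∀ (k : ℕ), 0 < k → k ≤ ℓ →
          ∀ ρ : Set (Fin k → Fin n), IsPC ℓ ρ →
            (∀ τ ∈ H, Preserves ⇑τ ρ) → Preserves ⇑π ρ} := by
    rintro ⟨k, hk, hkℓ, ρ, -, hρ, hH⟩
    refine Set.Subset.antisymm (fun π hπ _ _ _ _ _ h => h π hπ) fun π hπ => ?_
    rw [hH]
    exact hπ k hk hkℓ ρ (isPC_of_eq_hatRel_checkRel hρ) fun τ hτ => hH.subset hτ
  have hba : (H : Set (Perm (Fin n))) = {π : Perm (Fin n) | ∀ (k : ℕ), 0 < k → k ≤ ℓ →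
          ∀ ρ : Set (Fin k → Fin n), IsPC ℓ ρ →
            (∀ τ ∈ H, Preserves ⇑τ ρ) → Preserves ⇑π ρ} →
      ∃ G : Subgroup (Perm (Fin ℓ)),
        (H : Set (Perm (Fin n))) = CompSet n (G : Set (Perm (Fin ℓ))) := fun hH =>
    ⟨gPat ℓ (H : Set (Perm (Fin n))), (subset_compSet_gPat _).antisymm fun π hπ =>
      hH.superset fun k _ hkℓ ρ hρ hHρ => compSet_gPat_preserves hkℓ hn hρ hHρ hπ⟩
  exact ⟨⟨fun h => ⟨_, h⟩, fun ⟨G, hG⟩ => ha G hG⟩, ⟨fun h => hcb (hac h), hba⟩,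
    ⟨fun h => hac (hba h), hcb⟩⟩
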